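/- arXiv:2409.20281 — 2 statements merged into one kernel-verified Lean document; each statement's English description precedes it below -/
import Mathlib

section
/- Let G be a finite group of order 24 having a normal subgroup N that is isomorphic to the Klein four-group C₂ × C₂, such that the quotient G/N is isomorphic to the symmetric group Sym₃ and the centralizer of N in G equals N (equivalently, the conjugation action of G on N induces a faithful action of G/N on N). Then G is isomorphic to the symmetric group Sym₄. -/
namespace Subgroup

variable {G : Type*} [Group G]

theorem normalCore_eq_bot_of_disjoint_of_centralizer_le {N H : Subgroup G} [N.Normal]
    (hC : centralizer (N : Set G) ≤ N) (hNH : Disjoint N H) : H.normalCore = ⊥ := by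
  have hd : Disjoint H.normalCore N := (hNH.mono_right H.normalCore_le).symm
  refine hd.eq_bot_of_le fun x hx => hC (mem_centralizer_iff.2 fun n hn => ?_)
  exact (commute_of_normal_of_disjoint _ _ inferInstance inferInstance hd x n hx hn).eq.symm

theorem inf_normalizer_le_centralizer_of_disjoint {N P : Subgroup G} [hN : N.Normal]
    (hNP : Disjoint N P) : N ⊓ normalizer (P : Set G) ≤ centralizer (P : Set G) := by
  rintro n ⟨hn, hnP⟩
  refine mem_centralizer_iff.2 fun p hp => ?_
  have h₁ : n * p * n⁻¹ * p⁻¹ ∈ P := P.mul_mem ((mem_normalizer_iff.1 hnP p).1 hp) (P.inv_mem hp)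
  have h₂ : n * p * n⁻¹ * p⁻¹ ∈ N := by
    have h := N.mul_mem hn (hN.conj_mem _ (N.inv_mem hn) p)
    simpa only [mul_assoc] using h
  have h := disjoint_def.1 hNP h₂ h₁
  rw [mul_inv_eq_one, mul_inv_eq_iff_eq_mul] at h
  exact h.symm

/-- A `p`-subgroup acting nontrivially by conjugation on a normal subgroup of order `p + 1`
fixes only the identity. -/
theorem disjoint_centralizer_of_card_eq_prime_add_one {p : ℕ} [hp : Fact p.Prime]
    {N P : Subgroup G} [N.Normal] (hN : Nat.card N = p + 1) (hP : IsPGroup p P)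
    (hPN : ¬ P ≤ centralizer (N : Set G)) : Disjoint N (centralizer (P : Set G)) := by
  have : Finite N := Nat.finite_of_card_ne_zero (by omega)
  let K : Subgroup N := (centralizer (P : Set G)).subgroupOf N
  let _ : MulAction P N := MulAction.compHom N ((MulAut.conjNormal (H := N)).comp P.subtype)
  have hfix : MulAction.fixedPoints P N = (K : Set N) := by
    ext n
    simp only [MulAction.mem_fixedPoints, SetLike.mem_coe, K, mem_subgroupOf, mem_centralizer_iff]
    refine ⟨fun h g hg => ?_, fun h g => Subtype.ext ?_⟩
    · exact mul_inv_eq_iff_eq_mul.1 (congrArg Subtype.val (h ⟨g, hg⟩))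
    · exact mul_inv_eq_iff_eq_mul.2 (h g g.2)
  have hmod : p + 1 ≡ Nat.card K [MOD p] := by
    have h := hP.card_modEq_card_fixedPoints N
    rwa [hfix, hN] at h
  have hdvd : Nat.card K ∣ p + 1 := hN ▸ K.card_subgroup_dvd_card
  have hK : K = ⊥ := by
    by_contra hne
    have h1 : 1 < Nat.card K := K.one_lt_card_iff_ne_bot.2 hne
    have h2 : p ∣ Nat.card K - 1 := (Nat.modEq_iff_dvd' h1.le).1 (by
      simpa [Nat.ModEq] using hmod)
    have h3 := Nat.le_of_dvd (by omega) h2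
    have h4 := Nat.le_of_dvd (by omega) hdvd
    have hKtop : K = ⊤ := K.eq_top_of_card_eq (by omega)
    have hNP : N ≤ centralizer (P : Set G) := subgroupOf_eq_top.1 hKtop
    exact hPN (le_centralizer_iff.1 hNP)
  exact (subgroupOf_eq_bot.1 hK).symm

end Subgroup

open Subgroup in
/-- A group of order 24 with a normal Klein four subgroup `N` such that `G/N ≅ Sym₃`
and `C_G(N) = N` is isomorphic to `Sym₄`. -/
theorem stmt_0 (G : Type*) [Group G] (hcard : Nat.card G = 24)
    (N : Subgroup G) [N.Normal]
    (hN : Nonempty (↥N ≃* Multiplicative (ZMod 2) × Multiplicative (ZMod 2)))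
    (hQ : Nonempty ((G ⧸ N) ≃* Equiv.Perm (Fin 3)))
    (hC : Subgroup.centralizer (N : Set G) = N) :
    Nonempty (G ≃* Equiv.Perm (Fin 4)) := by
  have : Finite G := Nat.finite_of_card_ne_zero (by omega)
  have hN4 : Nat.card N = 4 := by
    obtain ⟨e⟩ := hN
    simp [Nat.card_congr e.toEquiv]
  have hN6 : N.index = 6 := by
    have := N.card_mul_index
    rw [hN4, hcard] at this
    omega
  have : Fact (Nat.Prime 3) := ⟨Nat.prime_three⟩
  let P : Sylow 3 G := default
  have hP : 3 ∣ Nat.card P := P.dvd_card_of_dvd_card (by omega)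
  have hPN : ¬ (P : Subgroup G) ≤ N := fun h => by
    have h34 := hP.trans (card_dvd_of_le h)
    rw [hN4] at h34
    omega
  have hNP : Disjoint N P := by
    obtain ⟨n, hn⟩ := IsPGroup.iff_card.1 P.isPGroup'
    refine disjoint_of_coprime_natCard ?_
    rw [hN4, hn]
    exact Nat.Coprime.pow_right n (by norm_num)
  let H : Subgroup G := normalizer ((P : Subgroup G) : Set G)
  have hNH : Disjoint N H := by
    have h := disjoint_centralizer_of_card_eq_prime_add_one hN4 P.isPGroup' (hC.symm ▸ hPN)
    exact disjoint_iff_inf_le.2 ((le_inf inf_le_left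
      (inf_normalizer_le_centralizer_of_disjoint hNP)).trans h.le_bot)
  have hH6 : Nat.card H ∣ 6 := by
    have h := relIndex_dvd_index_of_normal N H
    rwa [← inf_relIndex_right, hNH.eq_bot, relIndex_bot_left, hN6] at h
  have hHidx : H.index = 4 := by
    have hmod : H.index ≡ 1 [MOD 3] := P.card_eq_index_normalizer ▸ card_sylow_modEq_one 3 G
    have hmul := H.card_mul_index
    rw [hcard] at hmul
    have h3 : 3 ∣ Nat.card H := hP.trans (card_dvd_of_le le_normalizer)
    have hle := Nat.le_of_dvd (by omega) hH6
    unfold Nat.ModEq at hmod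
    interval_cases Nat.card H <;> omega
  have hinj : Function.Injective (MulAction.toPermHom G (G ⧸ H)) := by
    rw [← MonoidHom.ker_eq_bot_iff, ← normalCore_eq_ker]
    exact normalCore_eq_bot_of_disjoint_of_centralizer_le hC.le hNH
  let e : G ⧸ H ≃ Fin 4 := Finite.equivFinOfCardEq hHidx
  let f : G →* Equiv.Perm (Fin 4) := e.permCongrHom.toMonoidHom.comp (MulAction.toPermHom G (G ⧸ H))
  have hf : Function.Bijective f := by
    refine (Nat.bijective_iff_injective_and_card f).2 ⟨e.permCongrHom.injective.comp hinj, ?_⟩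
    rw [hcard, Nat.card_perm, Nat.card_fin]
    rfl
  exact ⟨MulEquiv.ofBijective f hf⟩
end

section
/- Let K be an algebraically closed field with char K ≠ 2, let ζ ∈ K be a primitive 8th root of unity, let Z be the central subgroup of SL₈(K) generated by ζ²·I₈, let π : SL₈(K) → SL₈(K)/Z be the quotient map, and set e := π(ζ·I₈). If x ∈ SL₈(K)/Z satisfies x² = 1, then there exists g ∈ SL₈(K) with g² = I₈ such that π(g) = x or π(g) = e·x. In other words, every involution x of SL₈(K)/Z is such that x or e·x lifts to an element of order dividing 2 in SL₈(K). -/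
/-- If `w` is central in `G` with `w ^ 2 = z`, then for every `x` in `G ⧸ ⟨z⟩` with `x ^ 2 = 1`,
one of `x` and `w * x` lifts to an element of `G` whose square is `1`. -/
theorem exists_sq_eq_one_lift {G : Type*} [Group G] {z w : G} [(Subgroup.zpowers z).Normal]
    (hwc : ∀ h, Commute w h) (hwz : w ^ 2 = z) (x : G ⧸ Subgroup.zpowers z) (hx : x ^ 2 = 1) :
    ∃ g : G, g ^ 2 = 1 ∧
      (QuotientGroup.mk' (Subgroup.zpowers z) g = x ∨
        QuotientGroup.mk' (Subgroup.zpowers z) g =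
          QuotientGroup.mk' (Subgroup.zpowers z) w * x) := by
  obtain ⟨a, rfl⟩ := QuotientGroup.mk'_surjective _ x
  rw [← map_pow, QuotientGroup.mk'_apply, QuotientGroup.eq_one_iff] at hx
  obtain ⟨k, hk⟩ := Subgroup.mem_zpowers_iff.mp hx
  have hz : ∀ j : ℤ, QuotientGroup.mk' (Subgroup.zpowers z) (z ^ j) = 1 := fun j ↦
    (QuotientGroup.eq_one_iff _).mpr (Subgroup.zpow_mem_zpowers z j)
  have hzw : ∀ j : ℤ, z ^ j = w ^ (2 * j) := fun j ↦ by
    rw [← hwz, zpow_mul, zpow_ofNat]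
  refine ⟨w ^ (-k) * a, ?_, ?_⟩
  · rw [((hwc a).zpow_left (-k)).mul_pow, ← hk, hzw, ← zpow_natCast, ← zpow_mul, ← zpow_add]
    convert zpow_zero w using 2
    push_cast
    ring
  · obtain ⟨m, rfl | rfl⟩ := Int.even_or_odd' k
    · left
      rw [← mul_neg, ← hzw, map_mul, hz, one_mul]
    · right
      rw [show -(2 * m + 1) = 2 * (-m - 1) + 1 by ring, zpow_add_one, ← hzw, mul_assoc, map_mul,
        hz, one_mul, map_mul]

/-- Let `ζ ∈ K` be a primitive 8th root of unity, `z = ζ²·I₈` and `w = ζ·I₈` in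
`SL₈(K)`, `Z = ⟨z⟩`, and `π : SL₈(K) → SL₈(K)/Z` the quotient map, `e = π(w)`.
Every involution `x` of `SL₈(K)/Z` is such that `x` or `e·x` lifts to an element
of order dividing 2 in `SL₈(K)`. -/
theorem stmt_2 (K : Type*) [Field K] [IsAlgClosed K] (hchar : ringChar K ≠ 2)
    (ζ : K) (hζ : IsPrimitiveRoot ζ 8)
    (z w : Matrix.SpecialLinearGroup (Fin 8) K)
    (hz : (z : Matrix (Fin 8) (Fin 8) K) = ζ ^ 2 • 1)
    (hw : (w : Matrix (Fin 8) (Fin 8) K) = ζ • 1)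
    [hZ : (Subgroup.zpowers z).Normal]
    (x : Matrix.SpecialLinearGroup (Fin 8) K ⧸ Subgroup.zpowers z)
    (hx : x ^ 2 = 1) :
    ∃ g : Matrix.SpecialLinearGroup (Fin 8) K, g ^ 2 = 1 ∧
      (QuotientGroup.mk' (Subgroup.zpowers z) g = x ∨
        QuotientGroup.mk' (Subgroup.zpowers z) g =
          QuotientGroup.mk' (Subgroup.zpowers z) w * x) := by
  have hwz : w ^ 2 = z := by
    apply Subtype.ext
    rw [Matrix.SpecialLinearGroup.coe_pow, hw, hz, smul_pow, one_pow]
  have hwc : ∀ h, Commute w h := fun h ↦ by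
    apply Subtype.ext
    simp [hw]
  exact exists_sq_eq_one_lift hwc hwz x hx
end
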